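/- Let F_q be a finite field and G ≤ PGL_2(F_q) a cyclic subgroup of prime order s. For every integer m > d(G), the number N_q(m) of monic irreducible polynomials of degree m over F_q satisfies N_q(m) = ω_G(m, s) + ω_G(m·s, 1). -/

import Mathlib

open Polynomial

/-- `PGL₂(F)`: the quotient of `GL₂(F)` by its center. -/
abbrev PGL2 (F : Type*) [Field F] :=
  GL (Fin 2) F ⧸ Subgroup.center (GL (Fin 2) F)

/-- The class of `A ∈ GL₂(F)` in `PGL₂(F)`. -/
abbrev PGL2.mk {F : Type*} [Field F] (A : GL (Fin 2) F) : PGL2 F :=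
  QuotientGroup.mk A

/-- The Möbius function `(ax + b)/(cx + d)` associated to `A ∈ GL₂(F)`, as a
rational function over `F`. -/
noncomputable def mobiusRatFunc {F : Type*} [Field F] (A : GL (Fin 2) F) : RatFunc F :=
  (RatFunc.C (A.val 0 0) * RatFunc.X + RatFunc.C (A.val 0 1)) /
    (RatFunc.C (A.val 1 0) * RatFunc.X + RatFunc.C (A.val 1 1))

/-- The rational transform `f^Q = Σ_{i=0}^{deg f} f_i g^i h^{deg f - i}` of a monic
polynomial `f` with the rational function `Q = g/h`. -/
noncomputable def ratTransform {F : Type*} [Field F] (g h f : F[X]) : F[X] :=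
  ∑ i ∈ Finset.range (f.natDegree + 1), C (f.coeff i) * g ^ i * h ^ (f.natDegree - i)

/-- `Q = g/h` is a quotient map for the subgroup `G ≤ PGL₂(F)`: `g, h` are coprime,
`g` is monic of degree `|G|`, `0 ≤ deg h < deg g`, and `Q` is `G`-invariant, i.e.
`Q ∘ ([A] ∘ x) = Q` for all `[A] ∈ G` (equivalently, `F(Q) = F(x)^G`). -/
def IsQuotientMap {F : Type*} [Field F] (G : Subgroup (PGL2 F)) (g h : F[X]) : Prop :=
  g.Monic ∧ IsCoprime g h ∧ h ≠ 0 ∧ h.natDegree < g.natDegree ∧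
    g.natDegree = Nat.card G ∧
    ∀ A : GL (Fin 2) F, PGL2.mk A ∈ G →
      Polynomial.aeval (mobiusRatFunc A) g / Polynomial.aeval (mobiusRatFunc A) h
        = algebraMap F[X] (RatFunc F) g / algebraMap F[X] (RatFunc F) h

/-- `d(Q)` for `Q = g/h`: the largest degree of a monic irreducible polynomial `f`
such that `f^Q` is not squarefree (`0` if no such polynomial exists). -/
noncomputable def dval {F : Type*} [Field F] (g h : F[X]) : ℕ :=
  sSup {n : ℕ | ∃ f : F[X], f.Monic ∧ Irreducible f ∧ f.natDegree = n ∧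
    ¬ Squarefree (ratTransform g h f)}

/-- The (non-normalized) Möbius substitution
`Σ_{i=0}^{deg f} f_i (ax+b)^i (cx+d)^{deg f - i}` of `f` by `A ∈ GL₂(F)`. -/
noncomputable def mobiusSubst {F : Type*} [Field F] (A : GL (Fin 2) F) (f : F[X]) : F[X] :=
  ∑ i ∈ Finset.range (f.natDegree + 1),
    C (f.coeff i) * (C (A.val 0 0) * X + C (A.val 0 1)) ^ i *
      (C (A.val 1 0) * X + C (A.val 1 1)) ^ (f.natDegree - i)

/-- `[A] ∗ f`: the unique monic scalar multiple of the Möbius substitution of `f`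
by `A`. -/
noncomputable def mobiusStar {F : Type*} [Field F] (A : GL (Fin 2) F) (f : F[X]) : F[X] :=
  C ((mobiusSubst A f).leadingCoeff)⁻¹ * mobiusSubst A f

/-- `f ∈ NR_q^G`: `f` is monic and has no root in the `G`-orbit of `∞` under the
Möbius action (the orbit point `[A] ∘ ∞` is `a/c` when `c ≠ 0`, and `∞` — which is
never a root of a monic polynomial — when `c = 0`). -/
def memNR {F : Type*} [Field F] (G : Subgroup (PGL2 F)) (f : F[X]) : Prop :=
  f.Monic ∧ ∀ A : GL (Fin 2) F, PGL2.mk A ∈ G → A.val 1 0 ≠ 0 →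
    f.eval (A.val 0 0 / A.val 1 0) ≠ 0

/-- `G ∗ r`: the `G`-orbit of the polynomial `r` under the `∗` action. -/
def polyOrbit {F : Type*} [Field F] (G : Subgroup (PGL2 F)) (r : F[X]) : Set F[X] :=
  {t : F[X] | ∃ A : GL (Fin 2) F, PGL2.mk A ∈ G ∧ t = mobiusStar A r}

/-- `ω_G(n, k)`: the number of `G`-orbits of size `k` of monic irreducible
polynomials of degree `n` in `NR_q^G`. -/
noncomputable def omegaG {F : Type*} [Field F] (G : Subgroup (PGL2 F)) (n k : ℕ) : ℕ :=
  {O : Set F[X] | ∃ r : F[X], memNR G r ∧ Irreducible r ∧ r.natDegree = n ∧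
    O = polyOrbit G r ∧ O.ncard = k}.ncard


section Mob
variable {F : Type*} [Field F] {K : Type*} [Field K] [Algebra F K]

/-- numerator -/
def mnum (A : GL (Fin 2) F) (x : K) : K :=
  algebraMap F K (A.val 0 0) * x + algebraMap F K (A.val 0 1)

/-- denominator -/
def mden (A : GL (Fin 2) F) (x : K) : K :=
  algebraMap F K (A.val 1 0) * x + algebraMap F K (A.val 1 1)

/-- Moebius map -/
noncomputable def mob (A : GL (Fin 2) F) (x : K) : K := mnum A x / mden A x

lemma gl_det_ne (A : GL (Fin 2) F) :
    A.val 0 0 * A.val 1 1 - A.val 0 1 * A.val 1 0 ≠ 0 := by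
  have := A.det.ne_zero
  rwa [Matrix.GeneralLinearGroup.val_det_apply, Matrix.det_fin_two] at this

lemma mnum_mden_ne (A : GL (Fin 2) F) (x : K) (h : mden A x = 0) : mnum A x ≠ 0 := by
  intro h2
  apply gl_det_ne A
  apply (algebraMap F K).injective
  simp only [mnum, mden] at h h2
  simp only [map_sub, map_mul, map_zero]
  by_cases h0 : algebraMap F K (A.val 1 0) = 0
  · simp [h0] at h ⊢
    simp [h]
  · apply mul_left_cancel₀ h0
    linear_combination (algebraMap F K (A.val 1 0)) * (algebraMap F K (A.val 0 0)) * h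
      - (algebraMap F K (A.val 1 0))^2 * h2

lemma mnum_mul (A B : GL (Fin 2) F) (x : K) :
    mnum (A * B) x = algebraMap F K (A.val 0 0) * mnum B x + algebraMap F K (A.val 0 1) * mden B x := by
  simp [mnum, mden, Matrix.mul_apply, Fin.sum_univ_two]; ring

lemma mden_mul (A B : GL (Fin 2) F) (x : K) :
    mden (A * B) x = algebraMap F K (A.val 1 0) * mnum B x + algebraMap F K (A.val 1 1) * mden B x := by
  simp [mnum, mden, Matrix.mul_apply, Fin.sum_univ_two]; ring

lemma mnum_mul' (A B : GL (Fin 2) F) (x : K) (hB : mden B x ≠ 0) :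
    mnum (A * B) x = mnum A (mob B x) * mden B x := by
  rw [mnum_mul, mob]; simp only [mnum]; field_simp

lemma mden_mul' (A B : GL (Fin 2) F) (x : K) (hB : mden B x ≠ 0) :
    mden (A * B) x = mden A (mob B x) * mden B x := by
  rw [mden_mul, mob]; conv_rhs => rw [mden]
  field_simp

lemma mob_mul (A B : GL (Fin 2) F) (x : K) (hB : mden B x ≠ 0) :
    mob (A * B) x = mob A (mob B x) := by
  rw [mob, mnum_mul' _ _ _ hB, mden_mul' _ _ _ hB, mul_div_mul_right _ _ hB]; rfl

lemma mob_one (x : K) : mob (1 : GL (Fin 2) F) x = x := by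
  simp [mob, mnum, mden]

lemma mden_one (x : K) : mden (1 : GL (Fin 2) F) x = 1 := by
  simp [mden]

lemma mk_eq_one_iff (A : GL (Fin 2) F) :
    PGL2.mk A = 1 ↔ A.val 0 1 = 0 ∧ A.val 1 0 = 0 ∧ A.val 0 0 = A.val 1 1 := by
  rw [PGL2.mk, QuotientGroup.eq_one_iff,
    Matrix.GeneralLinearGroup.mem_center_iff_val_mem_range_scalar]
  constructor
  · rintro ⟨u, hu⟩
    rw [← hu]; simp
  · rintro ⟨h1, h2, h3⟩
    refine ⟨A.val 0 0, ?_⟩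
    ext i j
    fin_cases i <;> fin_cases j <;> simp [h1, h2, h3]

lemma mk_eq_iff (A B : GL (Fin 2) F) (h : PGL2.mk A = PGL2.mk B) :
    ∃ u : F, u ≠ 0 ∧ ∀ i j, B.val i j = u * A.val i j := by
  have h1 : PGL2.mk (A⁻¹ * B) = 1 := by
    rw [PGL2.mk, QuotientGroup.mk_mul, QuotientGroup.mk_inv]
    rw [PGL2.mk, PGL2.mk] at h
    rw [h, inv_mul_cancel]
  obtain ⟨h01, h10, h00⟩ := (mk_eq_one_iff _).1 h1
  set D := A⁻¹ * B with hD
  have hB : B = A * D := by simp [hD]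
  have hdet := gl_det_ne D
  refine ⟨D.val 0 0, ?_, ?_⟩
  · intro h0
    rw [h01, h0] at hdet; simp at hdet
  · intro i j
    rw [hB]
    fin_cases j <;> simp [Matrix.mul_apply, Fin.sum_univ_two, h01, h10, ← h00, mul_comm]

lemma mob_congr (A B : GL (Fin 2) F) (h : PGL2.mk A = PGL2.mk B) (x : K) : mob A x = mob B x := by
  obtain ⟨u, hu, hAB⟩ := mk_eq_iff A B h
  have hu' : algebraMap F K u ≠ 0 := by simpa using hu
  simp only [mob, mnum, mden, hAB, map_mul]
  rw [mul_assoc, mul_assoc, ← mul_add, ← mul_add, mul_div_mul_left _ _ hu']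

lemma mden_congr (A B : GL (Fin 2) F) (h : PGL2.mk A = PGL2.mk B) (x : K) (hA : mden A x ≠ 0) :
    mden B x ≠ 0 := by
  obtain ⟨u, hu, hAB⟩ := mk_eq_iff A B h
  have hu' : algebraMap F K u ≠ 0 := by simpa using hu
  have : mden B x = algebraMap F K u * mden A x := by
    simp only [mden, hAB, map_mul]; ring
  rw [this]
  exact mul_ne_zero hu' hA

lemma fixed_quad (A : GL (Fin 2) F) (hA : PGL2.mk A ≠ 1) (x : K) (hd : mden A x ≠ 0)
    (hx : mob A x = x) : ∃ p : F[X], p ≠ 0 ∧ p.natDegree ≤ 2 ∧ aeval x p = 0 := by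
  refine ⟨C (A.val 1 0) * X ^ 2 + C (A.val 1 1 - A.val 0 0) * X + C (- A.val 0 1), ?_, ?_, ?_⟩
  · intro h0
    apply hA
    rw [mk_eq_one_iff]
    have h2 := congrArg (fun p => coeff p 2) h0
    have h1 := congrArg (fun p => coeff p 1) h0
    have h00 := congrArg (fun p => coeff p 0) h0
    simp [coeff_X, coeff_C, coeff_X_pow] at h2 h1 h00
    refine ⟨h00, h2, ?_⟩
    exact (sub_eq_zero.1 h1).symm
  · compute_degree
  · rw [mob, div_eq_iff hd] at hx
    simp only [mnum, mden] at hx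
    simp
    linear_combination -hx

lemma mob_map {L : Type*} [Field L] [Algebra F L] (σ : K →ₐ[F] L) (A : GL (Fin 2) F) (x : K) :
    mob A (σ x) = σ (mob A x) := by
  simp [mob, mnum, mden]

lemma mden_ratX (A : GL (Fin 2) F) : mden A (RatFunc.X : RatFunc F) ≠ 0 := by
  intro h
  have hdet := gl_det_ne A
  have : C (A.val 1 0) * X + C (A.val 1 1) = (0 : F[X]) := by
    by_contra h0
    exact RatFunc.transcendental_X (K := F) ⟨_, h0, by simpa [mden] using h⟩
  have h1 := congrArg (fun p => coeff p 1) this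
  have h0 := congrArg (fun p => coeff p 0) this
  simp [coeff_C] at h1 h0
  simp [h1, h0] at hdet

lemma mobiusRatFunc_eq (A : GL (Fin 2) F) : mobiusRatFunc A = mob A (RatFunc.X : RatFunc F) := by
  simp [mobiusRatFunc, mob, mnum, mden, RatFunc.algebraMap_eq_C]

lemma mob_ratX_inj (A B : GL (Fin 2) F)
    (h : mob A (RatFunc.X : RatFunc F) = mob B (RatFunc.X : RatFunc F)) :
    PGL2.mk A = PGL2.mk B := by
  have h1 : mob (B⁻¹ * A) (RatFunc.X : RatFunc F) = RatFunc.X := by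
    rw [mob_mul _ _ _ (mden_ratX _), h, ← mob_mul _ _ _ (mden_ratX _), inv_mul_cancel, mob_one]
  by_contra hne
  have h2 : PGL2.mk (B⁻¹ * A) ≠ 1 := by
    intro h3
    apply hne
    rw [PGL2.mk, QuotientGroup.mk_mul, QuotientGroup.mk_inv, inv_mul_eq_one] at h3
    exact h3.symm
  obtain ⟨p, hp0, -, hp⟩ := fixed_quad _ h2 _ (mden_ratX _) h1
  exact RatFunc.transcendental_X (K := F) ⟨p, hp0, hp⟩

/-! ### rational transform -/

lemma aeval_ratTransform (g h f : F[X]) (x : K) :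
    aeval x (ratTransform g h f) =
      ∑ i ∈ Finset.range (f.natDegree + 1),
        algebraMap F K (f.coeff i) * (aeval x g) ^ i * (aeval x h) ^ (f.natDegree - i) := by
  simp [ratTransform, map_sum]

lemma aeval_ratTransform_of_ne (g h f : F[X]) (x : K) (hx : aeval x h ≠ 0) :
    aeval x (ratTransform g h f) = (aeval x h) ^ f.natDegree * aeval (aeval x g / aeval x h) f := by
  rw [aeval_ratTransform, aeval_eq_sum_range (p := f), Finset.mul_sum]
  refine Finset.sum_congr rfl fun i hi => ?_
  have hi' : i ≤ f.natDegree := by simpa [Nat.lt_succ_iff] using hi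
  rw [Algebra.smul_def, div_pow]
  have : aeval x h ^ f.natDegree = aeval x h ^ (f.natDegree - i) * aeval x h ^ i := by
    rw [← pow_add, Nat.sub_add_cancel hi']
  rw [this]; field_simp

lemma aeval_ratTransform_of_eq (g h f : F[X]) (x : K) (hx : aeval x h = 0) :
    aeval x (ratTransform g h f) = algebraMap F K f.leadingCoeff * (aeval x g) ^ f.natDegree := by
  rw [aeval_ratTransform, Finset.sum_eq_single f.natDegree]
  · simp
  · intro i hi hne
    have hi' : i < f.natDegree := by
      have := Finset.mem_range.1 hi; omega
    rw [hx, zero_pow (by omega), mul_zero]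
  · simp

lemma ratTransform_root_iff (g h f : F[X]) (hf : f ≠ 0) (x : K)
    (hx : aeval x h = 0 → aeval x g ≠ 0) :
    aeval x (ratTransform g h f) = 0 ↔ aeval x h ≠ 0 ∧ aeval (aeval x g / aeval x h) f = 0 := by
  by_cases h0 : aeval x h = 0
  · rw [aeval_ratTransform_of_eq _ _ _ _ h0]
    simp [h0, hf, hx h0]
  · rw [aeval_ratTransform_of_ne _ _ _ _ h0]
    simp [h0]

lemma ratTransform_monic (g h f : F[X]) (hg : g.Monic) (hh : h.natDegree < g.natDegree)
    (hf : f.Monic) : (ratTransform g h f).Monic ∧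
      (ratTransform g h f).natDegree = f.natDegree * g.natDegree := by
  have hlead : (g ^ f.natDegree).Monic := hg.pow _
  have hdeg : (g ^ f.natDegree).natDegree = f.natDegree * g.natDegree := by
    rw [hg.natDegree_pow]
  have hsplit : ratTransform g h f = g ^ f.natDegree + ∑ i ∈ Finset.range f.natDegree,
      C (f.coeff i) * g ^ i * h ^ (f.natDegree - i) := by
    rw [ratTransform, Finset.sum_range_succ, add_comm]
    simp [hf]
  have hlow : (∑ i ∈ Finset.range f.natDegree,
      C (f.coeff i) * g ^ i * h ^ (f.natDegree - i)).degree < (g ^ f.natDegree).degree := by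
    rw [degree_eq_natDegree hlead.ne_zero, hdeg]
    rw [degree_lt_iff_coeff_zero]
    intro k hk
    rw [finsetSum_coeff]
    refine Finset.sum_eq_zero fun i hi => ?_
    apply coeff_eq_zero_of_natDegree_lt
    refine lt_of_lt_of_le ?_ hk
    have hi' := Finset.mem_range.1 hi
    calc _ ≤ i * g.natDegree + (f.natDegree - i) * h.natDegree := by
          refine natDegree_mul_le.trans (add_le_add ((natDegree_C_mul_le _ _).trans
            natDegree_pow_le) natDegree_pow_le)
      _ < i * g.natDegree + (f.natDegree - i) * g.natDegree := by
          have : 0 < f.natDegree - i := by omega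
          gcongr
      _ = f.natDegree * g.natDegree := by
          rw [← add_mul]; congr 1; omega
  rw [hsplit]
  exact ⟨hlead.add_of_left hlow, by rw [natDegree_add_eq_left_of_degree_lt hlow, hdeg]⟩

lemma mobiusSubst_eq (A : GL (Fin 2) F) (f : F[X]) : mobiusSubst A f =
    ratTransform (C (A.val 0 0) * X + C (A.val 0 1)) (C (A.val 1 0) * X + C (A.val 1 1)) f := rfl

lemma mobiusSubst_root_iff (A : GL (Fin 2) F) (f : F[X]) (hf : f ≠ 0) (x : K) :
    aeval x (mobiusSubst A f) = 0 ↔ mden A x ≠ 0 ∧ aeval (mob A x) f = 0 := by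
  rw [mobiusSubst_eq, ratTransform_root_iff _ _ _ hf]
  · simp [mob, mnum, mden]
  · simpa [mnum, mden] using mnum_mden_ne A x

lemma mobiusSubst_natDegree_le (A : GL (Fin 2) F) (f : F[X]) :
    (mobiusSubst A f).natDegree ≤ f.natDegree := by
  refine natDegree_sum_le_of_forall_le _ _ fun i hi => ?_
  have hi' := Finset.mem_range.1 hi
  calc _ ≤ i * 1 + (f.natDegree - i) * 1 := by
        refine natDegree_mul_le.trans (add_le_add ((natDegree_C_mul_le _ _).trans
            (natDegree_pow_le_of_le _ natDegree_linear_le))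
            (natDegree_pow_le_of_le _ natDegree_linear_le))
    _ = f.natDegree := by omega

end Mob

section Key
variable {F : Type*} [Field F] {G : Subgroup (PGL2 F)}

/-- representative -/
noncomputable def rep (γ : G) : GL (Fin 2) F := Quotient.out γ.1

lemma mk_rep (γ : G) : PGL2.mk (rep γ) = γ.1 := QuotientGroup.out_eq' γ.1

lemma rep_mem (γ : G) : PGL2.mk (rep γ) ∈ G := by rw [mk_rep]; exact γ.2

lemma key_ratfunc [Fintype G] {g h : F[X]} (hQ : IsQuotientMap G g h) :
    g.map (algebraMap F (RatFunc F)) -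
      C (algebraMap F[X] (RatFunc F) g / algebraMap F[X] (RatFunc F) h) *
        h.map (algebraMap F (RatFunc F))
    = ∏ γ : G, (X - C (mob (rep γ) (RatFunc.X : RatFunc F))) := by
  obtain ⟨hg, hcop, hh0, hdeg, hcard, hinv⟩ := hQ
  set Q := algebraMap F[X] (RatFunc F) g / algebraMap F[X] (RatFunc F) h with hQdef
  have hg0 : algebraMap F[X] (RatFunc F) g ≠ 0 := by simpa using hg.ne_zero
  have hh0' : algebraMap F[X] (RatFunc F) h ≠ 0 := by simpa using hh0
  have hQ0 : Q ≠ 0 := div_ne_zero hg0 hh0'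
  have hgm : (g.map (algebraMap F (RatFunc F))).Monic := hg.map _
  have hlt : (C Q * h.map (algebraMap F (RatFunc F))).degree <
      (g.map (algebraMap F (RatFunc F))).degree := by
    rw [degree_C_mul hQ0, degree_map, degree_map]
    exact degree_lt_degree hdeg
  apply eq_of_monic_of_dvd_of_natDegree_le
  · exact monic_prod_of_monic _ _ fun i _ => monic_X_sub_C _
  · exact hgm.sub_of_left hlt
  · apply Fintype.prod_dvd_of_coprime
    · apply pairwise_coprime_X_sub_C
      intro γ δ hγδ
      have := mob_ratX_inj _ _ hγδ
      rw [mk_rep, mk_rep] at this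
      exact Subtype.ext this
    · intro γ
      rw [dvd_iff_isRoot]
      have h1 := hinv (rep γ) (rep_mem γ)
      rw [mobiusRatFunc_eq] at h1
      have hne : aeval (mob (rep γ) (RatFunc.X : RatFunc F)) h ≠ 0 := by
        intro h0
        rw [h0, div_zero] at h1
        exact hQ0 h1.symm
      rw [div_eq_iff hne] at h1
      simp only [IsRoot.def, eval_sub, eval_mul, eval_C, eval_map_algebraMap]
      rw [h1]; simp [hQdef]
  · rw [natDegree_sub_eq_left_of_natDegree_lt (natDegree_lt_natDegree (by
      exact mul_ne_zero (by simpa using hQ0) (by simpa using hh0)) hlt), natDegree_map,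
      natDegree_finsetProd_X_sub_C_eq_card, hcard, Finset.card_univ, Nat.card_eq_fintype_card]

/-- denominator polynomial -/
noncomputable def denP (A : GL (Fin 2) F) : F[X] := C (A.val 1 0) * X + C (A.val 1 1)

/-- numerator polynomial -/
noncomputable def numP (A : GL (Fin 2) F) : F[X] := C (A.val 0 0) * X + C (A.val 0 1)

lemma algebraMap_denP (A : GL (Fin 2) F) :
    algebraMap F[X] (RatFunc F) (denP A) = mden A (RatFunc.X : RatFunc F) := by
  simp [denP, mden, RatFunc.algebraMap_eq_C]

lemma algebraMap_numP (A : GL (Fin 2) F) :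
    algebraMap F[X] (RatFunc F) (numP A) = mnum A (RatFunc.X : RatFunc F) := by
  simp [numP, mnum, RatFunc.algebraMap_eq_C]

lemma key_poly [Fintype G] {g h : F[X]} (hQ : IsQuotientMap G g h) :
    C (∏ γ : G, denP (rep γ)) *
      (C h * g.map (C : F →+* F[X]) - C g * h.map (C : F →+* F[X])) =
    C h * ∏ γ : G, (C (denP (rep γ)) * X - C (numP (rep γ)) : F[X][X]) := by
  apply map_injective (algebraMap F[X] (RatFunc F)) (RatFunc.algebraMap_injective F)
  have hk := key_ratfunc hQ
  have hh0' : algebraMap F[X] (RatFunc F) h ≠ 0 := by simpa using hQ.2.2.1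
  have hcomp : (algebraMap F[X] (RatFunc F)).comp (C : F →+* F[X]) = algebraMap F (RatFunc F) := by
    ext a; simp [RatFunc.algebraMap_eq_C]
  have e1 : C (algebraMap F[X] (RatFunc F) h) * g.map (algebraMap F (RatFunc F)) -
      C (algebraMap F[X] (RatFunc F) g) * h.map (algebraMap F (RatFunc F)) =
      C (algebraMap F[X] (RatFunc F) h) * (g.map (algebraMap F (RatFunc F)) -
      C (algebraMap F[X] (RatFunc F) g / algebraMap F[X] (RatFunc F) h) *
        h.map (algebraMap F (RatFunc F))) := by
    rw [mul_sub, ← mul_assoc, ← C_mul, mul_div_cancel₀ _ hh0']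
  have e2 : ∀ γ : G, (C (mden (rep γ) (RatFunc.X : RatFunc F)) * X -
      C (mnum (rep γ) (RatFunc.X : RatFunc F))) =
      C (mden (rep γ) (RatFunc.X : RatFunc F)) * (X - C (mob (rep γ) (RatFunc.X : RatFunc F))) := by
    intro γ
    rw [mul_sub, ← C_mul, mob, mul_div_cancel₀ _ (mden_ratX _)]
  simp only [Polynomial.map_mul, Polynomial.map_sub, Polynomial.map_prod, map_C, map_X, map_map,
    hcomp, map_prod, algebraMap_denP, algebraMap_numP]
  rw [e1, hk]
  simp only [e2, Finset.prod_mul_distrib]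
  ring

variable {K : Type*} [Field K] [Algebra F K]

lemma key_K [Fintype G] {g h : F[X]} (hQ : IsQuotientMap G g h) (x : K) :
    C (∏ γ : G, mden (rep γ) x) *
      (C (aeval x h) * g.map (algebraMap F K) - C (aeval x g) * h.map (algebraMap F K)) =
    C (aeval x h) * ∏ γ : G, (C (mden (rep γ) x) * X - C (mnum (rep γ) x)) := by
  have hk := congrArg (Polynomial.map (aeval (R := F) x : F[X] →ₐ[F] K).toRingHom) (key_poly hQ)
  have hcomp : (aeval (R := F) x : F[X] →ₐ[F] K).toRingHom.comp (C : F →+* F[X]) = algebraMap F K := by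
    ext a; simp
  simp only [Polynomial.map_mul, Polynomial.map_sub, Polynomial.map_prod, map_C, map_X, map_map,
    hcomp] at hk
  simpa [mden, mnum, map_prod, denP, numP] using hk

lemma cop_aeval {g h : F[X]} (hQ : IsQuotientMap G g h) (x : K) (hx : aeval x h = 0) :
    aeval x g ≠ 0 := by
  obtain ⟨u, v, huv⟩ := hQ.2.1
  intro h0
  have := congrArg (aeval x) huv
  simp [hx, h0] at this

lemma U_iff [Fintype G] {g h : F[X]} (hQ : IsQuotientMap G g h) (x : K) :
    aeval x h ≠ 0 ↔ ∀ γ : G, mden (rep γ) x ≠ 0 := by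
  have hk := key_K hQ x
  constructor
  · intro hx γ h0
    rw [Finset.prod_eq_zero (Finset.mem_univ γ) h0, C_0, zero_mul] at hk
    have hk := hk.symm
    rw [mul_eq_zero, Finset.prod_eq_zero_iff] at hk
    rcases hk with hk | ⟨δ, -, hδ⟩
    · exact hx (by simpa using hk)
    · have h1 := congrArg (fun p => coeff p 1) hδ
      have h2 := congrArg (fun p => coeff p 0) hδ
      simp [coeff_C] at h1 h2
      exact mnum_mden_ne _ _ h1 h2
  · intro hγ hx
    rw [hx] at hk
    simp only [C_0, zero_mul, zero_sub, mul_neg, neg_eq_zero, mul_eq_zero, C_eq_zero,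
      Polynomial.map_eq_zero, hQ.2.2.1, or_false, cop_aeval hQ x hx, Finset.prod_eq_zero_iff] at hk
    obtain ⟨δ, -, hδ⟩ := hk
    exact hγ δ hδ

lemma key_U [Fintype G] {g h : F[X]} (hQ : IsQuotientMap G g h) (x : K) (hx : aeval x h ≠ 0) :
    C (aeval x h) * g.map (algebraMap F K) - C (aeval x g) * h.map (algebraMap F K) =
    C (aeval x h) * ∏ γ : G, (X - C (mob (rep γ) x)) := by
  have hk := key_K hQ x
  have hd := (U_iff hQ x).1 hx
  have e2 : ∀ γ : G, (C (mden (rep γ) x) * X - C (mnum (rep γ) x)) =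
      C (mden (rep γ) x) * (X - C (mob (rep γ) x)) := by
    intro γ
    rw [mul_sub, ← C_mul, mob, mul_div_cancel₀ _ (hd _)]
  simp only [e2, Finset.prod_mul_distrib] at hk
  have hne : C (∏ γ : G, mden (rep γ) x) ≠ 0 := by
    rw [Ne, C_eq_zero]
    exact Finset.prod_ne_zero_iff.2 fun γ _ => hd γ
  apply mul_left_cancel₀ hne
  rw [hk, map_prod]; ring

lemma fiber [Fintype G] {g h : F[X]} (hQ : IsQuotientMap G g h) (x y : K) (hx : aeval x h ≠ 0)
    (hy : aeval y h ≠ 0) :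
    aeval x g / aeval x h = aeval y g / aeval y h ↔ ∃ γ : G, y = mob (rep γ) x := by
  have hk := congrArg (eval y) (key_U hQ x hx)
  simp only [eval_sub, eval_mul, eval_C, eval_map_algebraMap, eval_prod, eval_X] at hk
  rw [div_eq_div_iff hx hy]
  constructor
  · intro h1
    rw [h1, mul_comm, sub_self] at hk
    have hk := hk.symm
    rw [mul_eq_zero, or_iff_right hx, Finset.prod_eq_zero_iff] at hk
    obtain ⟨γ, -, hγ⟩ := hk
    exact ⟨γ, sub_eq_zero.1 hγ⟩
  · rintro ⟨γ, hγ⟩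
    rw [Finset.prod_eq_zero (Finset.mem_univ γ) (sub_eq_zero.2 hγ), mul_zero] at hk
    linear_combination -hk

lemma mden_ne [Fintype G] {g h : F[X]} (hQ : IsQuotientMap G g h) (x : K) (hx : aeval x h ≠ 0)
    (A : GL (Fin 2) F) (hA : PGL2.mk A ∈ G) : mden A x ≠ 0 :=
  mden_congr _ _ (mk_rep ⟨_, hA⟩) x ((U_iff hQ x).1 hx ⟨_, hA⟩)

lemma mob_mem [Fintype G] {g h : F[X]} (hQ : IsQuotientMap G g h) (x : K) (hx : aeval x h ≠ 0)
    (A : GL (Fin 2) F) (hA : PGL2.mk A ∈ G) : aeval (mob A x) h ≠ 0 := by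
  rw [U_iff hQ]
  intro γ h0
  have h1 := mden_ne hQ x hx A hA
  have h2 := mden_mul' (rep γ) A x h1
  rw [h0, zero_mul] at h2
  refine mden_ne hQ x hx (rep γ * A) ?_ h2
  rw [PGL2.mk, QuotientGroup.mk_mul]
  exact G.mul_mem (rep_mem γ) hA

lemma mob_inv_mob [Fintype G] {g h : F[X]} (hQ : IsQuotientMap G g h) (x : K) (hx : aeval x h ≠ 0)
    (A : GL (Fin 2) F) (hA : PGL2.mk A ∈ G) : mob A⁻¹ (mob A x) = x := by
  rw [← mob_mul _ _ _ (mden_ne hQ x hx A hA), inv_mul_cancel, mob_one]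

lemma mk_inv_mem {A : GL (Fin 2) F} (hA : PGL2.mk A ∈ G) : PGL2.mk A⁻¹ ∈ G := by
  rw [PGL2.mk, QuotientGroup.mk_inv]; exact G.inv_mem hA

lemma mob_mob_inv [Fintype G] {g h : F[X]} (hQ : IsQuotientMap G g h) (x : K) (hx : aeval x h ≠ 0)
    (A : GL (Fin 2) F) (hA : PGL2.mk A ∈ G) : mob A (mob A⁻¹ x) = x := by
  have := mob_inv_mob hQ x hx A⁻¹ (mk_inv_mem hA)
  rwa [inv_inv] at this

end Key

section Orb
variable {F : Type*} [Field F] {K : Type*} [Field K] [Algebra F K]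

/-- value of the quotient map -/
noncomputable def qv (g h : F[X]) (x : K) : K := aeval x g / aeval x h

lemma qv_map (g h : F[X]) (σ : K →ₐ[F] K) (x : K) : qv g h (σ x) = σ (qv g h x) := by
  simp [qv, aeval_algHom_apply]

open IntermediateField in
lemma natDegree_le_of_mem [Algebra.IsAlgebraic F K] (x y : K) (hy : y ∈ F⟮x⟯) :
    (minpoly F y).natDegree ≤ (minpoly F x).natDegree := by
  have hx : IsIntegral F x := Algebra.IsIntegral.isIntegral x
  have := adjoin.finiteDimensional hx
  rw [← adjoin.finrank hx]
  have h1 := minpoly.natDegree_le (A := F) (⟨y, hy⟩ : F⟮x⟯)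
  rwa [IntermediateField.minpoly_eq] at h1

open IntermediateField in
lemma aeval_mem_adj (x : K) (p : F[X]) : aeval x p ∈ F⟮x⟯ := by
  have : aeval x p = ((aeval (⟨x, mem_adjoin_simple_self F x⟩ : F⟮x⟯) p : F⟮x⟯) : K) := by
    rw [← IntermediateField.aeval_coe]
  rw [this]
  exact SetLike.coe_mem _

lemma qv_natDegree_le [Algebra.IsAlgebraic F K] (g h : F[X]) (x : K) :
    (minpoly F (qv g h x)).natDegree ≤ (minpoly F x).natDegree :=
  natDegree_le_of_mem _ _ (div_mem (aeval_mem_adj x g) (aeval_mem_adj x h))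

lemma mob_eq_qv (A : GL (Fin 2) F) (x : K) : mob A x = qv (numP A) (denP A) x := by
  simp [mob, qv, numP, denP, mnum, mden]

lemma mob_natDegree_le [Algebra.IsAlgebraic F K] (A : GL (Fin 2) F) (x : K) :
    (minpoly F (mob A x)).natDegree ≤ (minpoly F x).natDegree := by
  rw [mob_eq_qv]; exact qv_natDegree_le _ _ _

variable {G : Subgroup (PGL2 F)}

lemma mob_natDegree [Algebra.IsAlgebraic F K] [Fintype G] {g h : F[X]} (hQ : IsQuotientMap G g h)
    (x : K) (hx : aeval x h ≠ 0) (A : GL (Fin 2) F) (hA : PGL2.mk A ∈ G) :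
    (minpoly F (mob A x)).natDegree = (minpoly F x).natDegree := by
  refine le_antisymm (mob_natDegree_le A x) ?_
  have := mob_natDegree_le A⁻¹ (mob A x)
  rwa [mob_inv_mob hQ x hx A hA] at this

lemma star_minpoly [Algebra.IsAlgebraic F K] [Infinite K] [Fintype G] {g h : F[X]}
    (hQ : IsQuotientMap G g h)
    (x : K) (hx : aeval x h ≠ 0) (A : GL (Fin 2) F) (hA : PGL2.mk A ∈ G) :
    mobiusStar A (minpoly F x) = minpoly F (mob A⁻¹ x) := by
  have hA' := mk_inv_mem hA
  have hxi : IsIntegral F x := Algebra.IsIntegral.isIntegral x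
  have hyi : IsIntegral F (mob A⁻¹ x) := Algebra.IsIntegral.isIntegral _
  have hp0 := minpoly.ne_zero hxi
  have hS0 : mobiusSubst A (minpoly F x) ≠ 0 := by
    intro h0
    obtain ⟨y, hy⟩ : ∃ y : K, eval y ((minpoly F x * h).map (algebraMap F K)) ≠ 0 := by
      by_contra hcon
      push Not at hcon
      have : (minpoly F x * h).map (algebraMap F K) = 0 := Polynomial.funext (by simpa using hcon)
      rw [Polynomial.map_eq_zero] at this
      exact mul_ne_zero hp0 hQ.2.2.1 this
    rw [eval_map_algebraMap, map_mul] at hy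
    have hy1 := left_ne_zero_of_mul hy
    have hy2 := right_ne_zero_of_mul hy
    have := (mobiusSubst_root_iff A (minpoly F x) hp0 (mob A⁻¹ y)).1 (by rw [h0, map_zero])
    rw [mob_mob_inv hQ y hy2 A hA] at this
    exact hy1 this.2
  have hroot : aeval (mob A⁻¹ x) (mobiusSubst A (minpoly F x)) = 0 := by
    rw [mobiusSubst_root_iff _ _ hp0]
    refine ⟨mden_ne hQ _ (mob_mem hQ x hx _ hA') A hA, ?_⟩
    rw [mob_mob_inv hQ x hx A hA, minpoly.aeval]
  have hlc : (mobiusSubst A (minpoly F x)).leadingCoeff⁻¹ ≠ 0 := by simpa using hS0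
  apply eq_of_monic_of_dvd_of_natDegree_le (minpoly.monic hyi)
  · rw [mobiusStar, mul_comm]; exact monic_mul_leadingCoeff_inv hS0
  · rw [mobiusStar]; exact Dvd.dvd.mul_left (minpoly.dvd _ _ hroot) _
  · rw [mob_natDegree hQ x hx _ hA', mobiusStar, natDegree_C_mul hlc]
    exact mobiusSubst_natDegree_le _ _

lemma polyOrbit_eq [Algebra.IsAlgebraic F K] [Infinite K] [Fintype G] {g h : F[X]}
    (hQ : IsQuotientMap G g h) (x : K) (hx : aeval x h ≠ 0) :
    polyOrbit G (minpoly F x) = Set.range fun γ : G => minpoly F (mob (rep γ) x) := by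
  ext t
  constructor
  · rintro ⟨A, hA, rfl⟩
    refine ⟨⟨_, mk_inv_mem hA⟩, ?_⟩
    rw [star_minpoly hQ x hx A hA]
    simp only
    rw [mob_congr _ _ (mk_rep ⟨_, mk_inv_mem hA⟩)]
  · rintro ⟨γ, rfl⟩
    refine ⟨(rep γ)⁻¹, mk_inv_mem (rep_mem γ), ?_⟩
    rw [star_minpoly hQ x hx _ (mk_inv_mem (rep_mem γ)), inv_inv]

lemma polyOrbit_eq' [Infinite K] [Normal F K] [Fintype G] {g h : F[X]}
    (hQ : IsQuotientMap G g h) (x : K) (hx : aeval x h ≠ 0) :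
    polyOrbit G (minpoly F x) = {p | ∃ y : K, aeval y h ≠ 0 ∧
      minpoly F (qv g h y) = minpoly F (qv g h x) ∧ p = minpoly F y} := by
  rw [polyOrbit_eq hQ x hx]
  ext t
  constructor
  · rintro ⟨γ, rfl⟩
    have hm := mob_mem hQ x hx _ (rep_mem γ)
    refine ⟨_, hm, ?_, rfl⟩
    rw [qv, qv, (fiber hQ x _ hx hm).2 ⟨γ, rfl⟩]
  · rintro ⟨y, hy, hyx, rfl⟩
    obtain ⟨σ, hσ⟩ := (isConjRoot_iff_exists_algEquiv (K := F) (L := K)).1 hyx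
    have hσ' : qv g h (σ x) = qv g h y := by
      rw [← hσ]; exact qv_map g h (σ : K →ₐ[F] K) x
    have hσx : aeval (σ x) h ≠ 0 := by
      rw [show aeval (σ x) h = σ (aeval x h) from aeval_algHom_apply (σ : K →ₐ[F] K) x h]
      simpa using hx
    obtain ⟨γ, hγ⟩ := (fiber hQ (σ x) y hσx hy).1 hσ'
    refine ⟨γ, ?_⟩
    have h2 : mob (rep γ) (σ x) = σ (mob (rep γ) x) := mob_map (σ : K →ₐ[F] K) _ _
    simp only
    rw [hγ, h2, minpoly.algEquiv_eq]

lemma minpoly_mob_congr [Normal F K] (A : GL (Fin 2) F) (x y : K)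
    (hxy : minpoly F x = minpoly F y) : minpoly F (mob A x) = minpoly F (mob A y) := by
  obtain ⟨σ, hσ⟩ := (isConjRoot_iff_exists_algEquiv (K := F) (L := K)).1 hxy
  have h2 : mob A (σ y) = σ (mob A y) := mob_map (σ : K →ₐ[F] K) _ _
  rw [← hσ, h2, minpoly.algEquiv_eq]

lemma mob_rep_mul [Fintype G] {g h : F[X]} (hQ : IsQuotientMap G g h) (x : K)
    (hx : aeval x h ≠ 0) (γ δ : G) :
    mob (rep (γ * δ)) x = mob (rep γ) (mob (rep δ) x) := by
  rw [← mob_mul _ _ _ (mden_ne hQ x hx _ (rep_mem δ))]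
  apply mob_congr
  rw [mk_rep]
  conv_rhs => rw [PGL2.mk, QuotientGroup.mk_mul]
  have h1 := mk_rep γ
  have h2 := mk_rep δ
  rw [PGL2.mk] at h1 h2
  rw [h1, h2]; rfl

lemma mob_rep_one (x : K) : mob (rep (1 : G)) x = x := by
  rw [mob_congr _ 1 (by rw [mk_rep]; rfl), mob_one]

lemma orbit_card [Infinite K] [Normal F K] [Fintype G] {g h : F[X]}
    (hQ : IsQuotientMap G g h) (hp : (Nat.card G).Prime) (x : K) (hx : aeval x h ≠ 0) :
    (polyOrbit G (minpoly F x)).ncard = 1 ∨ (polyOrbit G (minpoly F x)).ncard = Nat.card G := by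
  rw [polyOrbit_eq hQ x hx]
  have : Fact (Nat.card G).Prime := ⟨hp⟩
  let S : Subgroup G :=
    { carrier := {γ | minpoly F (mob (rep γ) x) = minpoly F x}
      one_mem' := by simp [mob_rep_one]
      mul_mem' := by
        intro γ δ h1 h2
        simp only [Set.mem_ofPred_eq] at h1 h2 ⊢
        rw [mob_rep_mul hQ x hx, minpoly_mob_congr _ _ _ h2, h1]
      inv_mem' := by
        intro γ h1
        simp only [Set.mem_ofPred_eq] at h1 ⊢
        rw [← minpoly_mob_congr _ _ _ h1, ← mob_rep_mul hQ x hx, inv_mul_cancel, mob_rep_one] }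
  have hS : ∀ γ, γ ∈ S ↔ minpoly F (mob (rep γ) x) = minpoly F x := fun γ => Iff.rfl
  rcases S.eq_bot_or_eq_top_of_prime_card with h | h
  · right
    rw [← Set.image_univ, Set.ncard_image_of_injective, Set.ncard_univ]
    intro γ δ hγδ
    have h1 : δ⁻¹ * γ ∈ S := by
      rw [hS, mob_rep_mul hQ x hx, minpoly_mob_congr _ _ _ hγδ, ← mob_rep_mul hQ x hx,
        inv_mul_cancel, mob_rep_one]
    rw [h, Subgroup.mem_bot, inv_mul_eq_one] at h1
    exact h1.symm
  · left
    have : (Set.range fun γ : G => minpoly F (mob (rep γ) x)) = {minpoly F x} := by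
      ext t
      constructor
      · rintro ⟨γ, rfl⟩
        exact (hS γ).1 (by rw [h]; trivial)
      · rintro rfl
        exact ⟨1, by simp [mob_rep_one]⟩
    rw [this, Set.ncard_singleton]

lemma memNR_minpoly [Algebra.IsAlgebraic F K] [Fintype G] {g h : F[X]}
    (hQ : IsQuotientMap G g h) (x : K) (hx : aeval x h ≠ 0) : memNR G (minpoly F x) := by
  have hxi : IsIntegral F x := Algebra.IsIntegral.isIntegral x
  refine ⟨minpoly.monic hxi, ?_⟩
  intro A hA hc h0
  set u := A.val 0 0 / A.val 1 0 with hu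
  have h1 : minpoly F x = X - C u := by
    symm
    apply eq_of_monic_of_associated (monic_X_sub_C u) (minpoly.monic hxi)
    exact (irreducible_X_sub_C u).associated_of_dvd (minpoly.irreducible hxi)
      (dvd_iff_isRoot.2 h0)
  have h2 : x = algebraMap F K u := by
    have := minpoly.aeval F x
    rw [h1] at this
    simpa [sub_eq_zero] using this
  have h3 := mden_ne hQ x hx A⁻¹ (mk_inv_mem hA)
  apply h3
  have h4 : (A⁻¹ * A).val 1 0 = 0 := by rw [inv_mul_cancel]; simp
  have h5 : A⁻¹.val 1 0 * A.val 0 0 + A⁻¹.val 1 1 * A.val 1 0 = 0 := by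
    rw [← h4, Units.val_mul, Matrix.mul_apply, Fin.sum_univ_two]
  rw [mden, h2, ← map_mul, ← map_add]
  convert map_zero (algebraMap F K)
  rw [hu]
  generalize A⁻¹.val 1 0 = c' at *
  generalize A⁻¹.val 1 1 = d' at *
  field_simp
  linear_combination h5

lemma U_of_memNR [Fintype G] {g h : F[X]}
    (hQ : IsQuotientMap G g h) (r : F[X]) (hr : memNR G r) (x : K) (hx : aeval x r = 0) :
    aeval x h ≠ 0 := by
  rw [U_iff hQ]
  intro γ h0
  have h4 : ((rep γ) * (rep γ)⁻¹).val 1 0 = 0 := by rw [mul_inv_cancel]; simp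
  have h5 : (rep γ).val 1 0 * (rep γ)⁻¹.val 0 0 + (rep γ).val 1 1 * (rep γ)⁻¹.val 1 0 = 0 := by
    rw [← h4, Units.val_mul, Matrix.mul_apply, Fin.sum_univ_two]
  have h6 := hr.2 (rep γ)⁻¹ (mk_inv_mem (rep_mem γ))
  have hd1 := gl_det_ne (rep γ)
  have hd2 := gl_det_ne (rep γ)⁻¹
  rw [mden] at h0
  generalize (rep γ)⁻¹.val 0 0 = a' at *
  generalize (rep γ)⁻¹.val 1 0 = c' at *
  generalize (rep γ).val 1 0 = c at *
  generalize (rep γ).val 1 1 = d at *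
  have hc : c ≠ 0 := by
    rintro rfl
    have : d = 0 := by simpa using h0
    simp [this] at hd1
  have hc' : c' ≠ 0 := by
    rintro rfl
    have : a' = 0 := by simpa [hc] using h5
    simp [this] at hd2
  apply h6 hc'
  have hxe : x = algebraMap F K (a' / c') := by
    have e : a' / c' = - d / c := by
      field_simp; linear_combination h5
    have hcK : algebraMap F K c ≠ 0 := by simpa using hc
    rw [e, map_div₀, map_neg]
    field_simp; linear_combination h0
  rw [hxe, aeval_algebraMap_apply] at hx
  simpa using hx

end Orb

section Sq

lemma ratTransform_mul_linear {K : Type*} [Field K] (g h u : K[X]) (hh : h ≠ 0) (hu : u ≠ 0)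
    (b : K) : ratTransform g h ((X - C b) * u) = (g - C b * h) * ratTransform g h u := by
  apply RatFunc.algebraMap_injective K
  have key : ∀ p : K[X], algebraMap K[X] (RatFunc K) p = aeval (RatFunc.X : RatFunc K) p := by
    intro p; rw [← RatFunc.algebraMap_X, aeval_algebraMap_apply]; simp
  have hh' : aeval (RatFunc.X : RatFunc K) h ≠ 0 := by rw [← key]; simpa using hh
  have hd : ((X - C b) * u).natDegree = u.natDegree + 1 := by
    rw [natDegree_mul (X_sub_C_ne_zero b) hu, natDegree_X_sub_C, add_comm]
  rw [key, key, map_mul, aeval_ratTransform_of_ne _ _ _ _ hh', aeval_ratTransform_of_ne _ _ _ _ hh',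
    hd, map_mul, map_sub, map_sub, map_mul, aeval_X, aeval_C, aeval_C]
  field_simp
  ring

lemma ratTransform_map {F K : Type*} [Field F] [Field K] (φ : F →+* K) (g h f : F[X]) :
    (ratTransform g h f).map φ = ratTransform (g.map φ) (h.map φ) (f.map φ) := by
  simp [ratTransform, Polynomial.map_sum]

variable {F : Type*} [Field F] {K : Type*} [Field K] [Algebra F K] {G : Subgroup (PGL2 F)}

lemma sq_bound [PerfectField F] [IsAlgClosed K] [Normal F K] [Fintype G] {g h : F[X]}
    (hQ : IsQuotientMap G g h) (f : F[X]) (hf : f.Monic) (hirr : Irreducible f)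
    (hsq : ¬ Squarefree (ratTransform g h f)) : f.natDegree ≤ 2 := by
  rw [Squarefree] at hsq
  push Not at hsq
  obtain ⟨p, hpd, hpu⟩ := hsq
  have hfQ := ratTransform_monic g h f hQ.1 hQ.2.2.2.1 hf
  have hp0 : p ≠ 0 := by
    rintro rfl
    rw [zero_mul, zero_dvd_iff] at hpd
    exact hfQ.1.ne_zero hpd
  obtain ⟨x, hx⟩ := IsAlgClosed.exists_aeval_eq_zero K p (by
    intro hd; exact hpu (isUnit_iff_degree_eq_zero.2 hd))
  have hxQ : aeval x (ratTransform g h f) = 0 := by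
    obtain ⟨q, hq⟩ := hpd
    rw [hq]; simp [hx]
  obtain ⟨hxU, hfx⟩ := (ratTransform_root_iff g h f hf.ne_zero x (cop_aeval hQ x)).1 hxQ
  change aeval (qv g h x) f = 0 at hfx
  have hfmin : f = minpoly F (qv g h x) := minpoly.eq_of_irreducible_of_monic hirr hfx hf
  set b := qv g h x with hb
  obtain ⟨u, hu⟩ : X - C b ∣ f.map (algebraMap F K) := by
    rw [dvd_iff_isRoot, IsRoot.def, eval_map_algebraMap]; exact hfx
  have hfK0 : f.map (algebraMap F K) ≠ 0 := by simpa using hf.ne_zero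
  have hu0 : u ≠ 0 := by
    rintro rfl; rw [mul_zero] at hu; exact hfK0 hu
  have hub : eval b u ≠ 0 := by
    intro h0
    have hsep := PerfectField.separable_of_irreducible hirr
    apply hsep.aeval_derivative_ne_zero hfx
    rw [← eval_map_algebraMap, ← derivative_map, hu]
    simp [h0]
  have hhK : h.map (algebraMap F K) ≠ 0 := by simpa using hQ.2.2.1
  have hfac := ratTransform_map (algebraMap F K) g h f
  rw [hu, ratTransform_mul_linear _ _ _ hhK hu0] at hfac
  have huQ : eval x (ratTransform (g.map (algebraMap F K)) (h.map (algebraMap F K)) u) ≠ 0 := by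
    have := aeval_ratTransform_of_ne (g.map (algebraMap F K)) (h.map (algebraMap F K)) u x
      (by simpa using hxU)
    simp only [coe_aeval_eq_eval, eval_map_algebraMap] at this
    rw [this]
    exact mul_ne_zero (pow_ne_zero _ hxU) hub
  have hd2 : (X - C x) ^ 2 ∣ (ratTransform g h f).map (algebraMap F K) := by
    have h1 : (X - C x) ∣ p.map (algebraMap F K) := by
      rw [dvd_iff_isRoot, IsRoot.def, eval_map_algebraMap]; exact hx
    have h2 := Polynomial.map_dvd (algebraMap F K) hpd
    rw [Polynomial.map_mul] at h2
    rw [sq]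
    exact (mul_dvd_mul h1 h1).trans h2
  rw [hfac] at hd2
  have hcop : IsCoprime ((X - C x) ^ 2)
      (ratTransform (g.map (algebraMap F K)) (h.map (algebraMap F K)) u) := by
    apply IsCoprime.pow_left
    rw [(irreducible_X_sub_C x).coprime_iff_not_dvd, dvd_iff_isRoot]
    exact huQ
  have hd3 := hcop.dvd_of_dvd_mul_right hd2
  have hd4 : (X - C x) ^ 2 ∣ C (aeval x h) * ∏ γ : G, (X - C (mob (rep γ) x)) := by
    rw [← key_U hQ x hxU]
    have : C (aeval x h) * g.map (algebraMap F K) - C (aeval x g) * h.map (algebraMap F K) =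
        C (aeval x h) * (g.map (algebraMap F K) - C b * h.map (algebraMap F K)) := by
      rw [mul_sub, ← mul_assoc, ← C_mul, hb, qv, mul_div_cancel₀ _ hxU]
    rw [this]
    exact Dvd.dvd.mul_left hd3 _
  classical
  rw [← Finset.mul_prod_erase _ _ (Finset.mem_univ (1 : G)), mob_rep_one, mul_left_comm, sq] at hd4
  have hd5 := (mul_dvd_mul_iff_left (X_sub_C_ne_zero x)).1 hd4
  rw [dvd_iff_isRoot, IsRoot.def, eval_mul, eval_C, mul_eq_zero, or_iff_right hxU, eval_prod,
    Finset.prod_eq_zero_iff] at hd5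
  obtain ⟨γ, hγ, hγx⟩ := hd5
  have hγ1 := Finset.ne_of_mem_erase hγ
  have hfix : mob (rep γ) x = x := by
    simp [sub_eq_zero] at hγx
    exact hγx.symm
  obtain ⟨q, hq0, hq2, hqx⟩ := fixed_quad (rep γ) (by
    rw [mk_rep]; intro h1; exact hγ1 (Subtype.ext h1)) x ((U_iff hQ x).1 hxU γ) hfix
  calc f.natDegree ≤ (minpoly F x).natDegree := by
        rw [hfmin]; exact qv_natDegree_le g h x
    _ ≤ q.natDegree := natDegree_le_of_dvd (minpoly.dvd _ _ hqx) hq0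
    _ ≤ 2 := hq2

lemma sq_of_lt [PerfectField F] [Fintype G] {g h : F[X]}
    (hQ : IsQuotientMap G g h) (f : F[X]) (hf : f.Monic) (hirr : Irreducible f)
    (hlt : dval g h < f.natDegree) : Squarefree (ratTransform g h f) := by
  by_contra hsq
  refine absurd hlt (not_lt.2 (le_csSup ⟨2, ?_⟩ ⟨f, hf, hirr, rfl, hsq⟩))
  rintro n ⟨f', hf', hi', rfl, hs'⟩
  exact sq_bound (K := AlgebraicClosure F) hQ f' hf' hi' hs'

lemma deg_count [IsAlgClosed K] [Normal F K] [Fintype G] {g h : F[X]}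
    (hQ : IsQuotientMap G g h) (x : K) (hx : aeval x h ≠ 0) :
    (polyOrbit G (minpoly F x)).ncard * (minpoly F x).natDegree ≤
      (minpoly F (qv g h x)).natDegree * Nat.card G ∧
    (Squarefree (ratTransform g h (minpoly F (qv g h x))) →
      (polyOrbit G (minpoly F x)).ncard * (minpoly F x).natDegree =
      (minpoly F (qv g h x)).natDegree * Nat.card G) := by
  classical
  have : Infinite K := IsAlgClosed.instInfinite
  have hint : ∀ y : K, IsIntegral F y := fun y => Algebra.IsIntegral.isIntegral y
  set f := minpoly F (qv g h x) with hfdef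
  have hf : f.Monic := minpoly.monic (hint _)
  have hfQ := ratTransform_monic g h f hQ.1 hQ.2.2.2.1 hf
  rw [hQ.2.2.2.2.1] at hfQ
  have hfin : (polyOrbit G (minpoly F x)).Finite := by
    rw [polyOrbit_eq hQ x hx]; exact Set.finite_range _
  set T := hfin.toFinset with hT
  have hcard : (polyOrbit G (minpoly F x)).ncard = T.card := Set.ncard_eq_toFinset_card _ hfin
  have hmem : ∀ p, p ∈ T ↔ ∃ y : K, aeval y h ≠ 0 ∧ minpoly F (qv g h y) = f ∧
      p = minpoly F y := by
    intro p
    rw [hT, Set.Finite.mem_toFinset, polyOrbit_eq' hQ x hx]; rfl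
  have hdeg : ∀ p ∈ T, p.natDegree = (minpoly F x).natDegree := by
    intro p hp
    rw [hT, Set.Finite.mem_toFinset, polyOrbit_eq hQ x hx] at hp
    obtain ⟨γ, rfl⟩ := hp
    exact mob_natDegree hQ x hx _ (rep_mem γ)
  have hmon : ∀ p ∈ T, p.Monic := by
    intro p hp
    obtain ⟨y, -, -, rfl⟩ := (hmem p).1 hp
    exact minpoly.monic (hint y)
  have hirr : ∀ p ∈ T, Irreducible p := by
    intro p hp
    obtain ⟨y, -, -, rfl⟩ := (hmem p).1 hp
    exact minpoly.irreducible (hint y)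
  have hprod : (∏ p ∈ T, p).natDegree = T.card * (minpoly F x).natDegree := by
    rw [natDegree_prod_of_monic _ _ hmon, Finset.sum_congr rfl hdeg]; simp
  have hprodm : (∏ p ∈ T, p).Monic := monic_prod_of_monic _ _ hmon
  have hdvd : ∏ p ∈ T, p ∣ ratTransform g h f := by
    apply Finset.prod_dvd_of_coprime
    · intro p hp q hq hpq
      rw [Function.onFun, (hirr p hp).coprime_iff_not_dvd]
      intro hd
      exact hpq (eq_of_monic_of_associated (hmon p hp) (hmon q hq)
        ((hirr p hp).associated_of_dvd (hirr q hq) hd))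
    · intro p hp
      obtain ⟨y, hy, hyf, rfl⟩ := (hmem p).1 hp
      apply minpoly.dvd
      rw [ratTransform_root_iff g h f hf.ne_zero y (cop_aeval hQ y)]
      refine ⟨hy, ?_⟩
      rw [← hyf]; exact minpoly.aeval F (qv g h y)
  rw [hcard, ← hprod, ← hfQ.2]
  refine ⟨natDegree_le_of_dvd hdvd hfQ.1.ne_zero, fun hsq => ?_⟩
  refine le_antisymm (natDegree_le_of_dvd hdvd hfQ.1.ne_zero)
    (natDegree_le_of_dvd ?_ hprodm.ne_zero)
  rw [UniqueFactorizationMonoid.dvd_iff_normalizedFactors_le_normalizedFactors hfQ.1.ne_zero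
    hprodm.ne_zero, Multiset.le_iff_subset
    ((UniqueFactorizationMonoid.squarefree_iff_nodup_normalizedFactors hfQ.1.ne_zero).1 hsq)]
  intro r hr
  have hri := UniqueFactorizationMonoid.irreducible_of_normalized_factor r hr
  have hrd := UniqueFactorizationMonoid.dvd_of_mem_normalizedFactors hr
  have hrn := UniqueFactorizationMonoid.normalize_normalized_factor r hr
  have hrm : r.Monic := by rw [← hrn]; exact monic_normalize hri.ne_zero
  obtain ⟨y, hy⟩ := IsAlgClosed.exists_aeval_eq_zero K r hri.degree_pos.ne'
  have hyQ : aeval y (ratTransform g h f) = 0 := by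
    obtain ⟨q, hq⟩ := hrd
    rw [hq]; simp [hy]
  obtain ⟨hyU, hfy⟩ := (ratTransform_root_iff g h f hf.ne_zero y (cop_aeval hQ y)).1 hyQ
  have hrT : r ∈ T := (hmem r).2 ⟨y, hyU,
    (minpoly.eq_of_irreducible_of_monic (minpoly.irreducible (hint _)) hfy hf).symm,
    minpoly.eq_of_irreducible_of_monic hri hy hrm⟩
  rw [UniqueFactorizationMonoid.mem_normalizedFactors_iff' hprodm.ne_zero]
  exact ⟨hri, hrn, Finset.dvd_prod_of_mem _ hrT⟩

lemma exists_U [IsAlgClosed K] [Normal F K] [Fintype G] {g h : F[X]}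
    (hQ : IsQuotientMap G g h) (f : F[X]) (hf : f.Monic) (hirr : Irreducible f) :
    ∃ x : K, aeval x h ≠ 0 ∧ f = minpoly F (qv g h x) := by
  have hfQ := ratTransform_monic g h f hQ.1 hQ.2.2.2.1 hf
  have hg : 0 < g.natDegree := by have := hQ.2.2.2.1; omega
  obtain ⟨x, hx⟩ := IsAlgClosed.exists_aeval_eq_zero K (ratTransform g h f) (by
    apply ne_of_gt
    rw [← natDegree_pos_iff_degree_pos, hfQ.2]
    exact Nat.mul_pos hirr.natDegree_pos hg)
  obtain ⟨hyU, hfy⟩ := (ratTransform_root_iff g h f hf.ne_zero x (cop_aeval hQ x)).1 hx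
  exact ⟨x, hyU, minpoly.eq_of_irreducible_of_monic hirr hfy hf⟩

lemma finite_deg [Finite F] (m : ℕ) :
    {f : F[X] | f.Monic ∧ Irreducible f ∧ f.natDegree = m}.Finite := by
  have : Finite (degreeLT F (m + 1)) := Finite.of_equiv _ (degreeLTEquiv F (m + 1)).symm.toEquiv
  refine Set.Finite.subset (Set.toFinite (degreeLT F (m + 1) : Set F[X])) ?_
  rintro f ⟨hf, -, hd⟩
  rw [SetLike.mem_coe, mem_degreeLT, degree_eq_natDegree hf.ne_zero, hd]
  exact_mod_cast Nat.lt_succ_self m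

end Sq

theorem count_irreducible_eq_omega_add_omega (F : Type*) [Field F] [Fintype F]
    (G : Subgroup (PGL2 F)) (s : ℕ) (hs : s.Prime) (hG : Nat.card G = s)
    (hcyc : IsCyclic ↥G) (g h : F[X]) (hQ : IsQuotientMap G g h)
    (m : ℕ) (hm : dval g h < m) :
    {f : F[X] | f.Monic ∧ Irreducible f ∧ f.natDegree = m}.ncard
      = omegaG G m s + omegaG G (m * s) 1 := by
  classical
  have : Finite G := inferInstance
  have : Fintype G := Fintype.ofFinite G
  have hint : ∀ y : AlgebraicClosure F, IsIntegral F y := fun y => Algebra.IsIntegral.isIntegral y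
  have : Infinite (AlgebraicClosure F) := IsAlgClosed.instInfinite
  have hp : (Nat.card G).Prime := hG ▸ hs
  let Φ : F[X] → Set F[X] := fun f => {p | ∃ y : AlgebraicClosure F, aeval y h ≠ 0 ∧
      minpoly F (qv g h y) = f ∧ p = minpoly F y}
  have hΦ : ∀ x : AlgebraicClosure F, aeval x h ≠ 0 →
      polyOrbit G (minpoly F x) = Φ (minpoly F (qv g h x)) := fun x hx => polyOrbit_eq' hQ x hx
  have hinj : Set.InjOn Φ {f : F[X] | f.Monic ∧ Irreducible f ∧ f.natDegree = m} := by
    rintro f ⟨hf, hfi, -⟩ f' ⟨hf', hfi', -⟩ hff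
    obtain ⟨x, hx, hfx⟩ := exists_U (K := AlgebraicClosure F) hQ f hf hfi
    have : minpoly F x ∈ Φ f := ⟨x, hx, hfx.symm, rfl⟩
    rw [hff] at this
    obtain ⟨y, hy, hyf, hxy⟩ := this
    obtain ⟨σ, hσ⟩ := (isConjRoot_iff_exists_algEquiv (K := F) (L := AlgebraicClosure F)).1 hxy
    rw [hfx, ← hyf, ← hσ, show qv g h (σ y) = σ (qv g h y) from
      qv_map g h (σ : AlgebraicClosure F →ₐ[F] AlgebraicClosure F) y, minpoly.algEquiv_eq]
  have himg : Φ '' {f : F[X] | f.Monic ∧ Irreducible f ∧ f.natDegree = m} =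
      {O : Set F[X] | ∃ r : F[X], memNR G r ∧ Irreducible r ∧ r.natDegree = m ∧
        O = polyOrbit G r ∧ O.ncard = s} ∪
      {O : Set F[X] | ∃ r : F[X], memNR G r ∧ Irreducible r ∧ r.natDegree = m * s ∧
        O = polyOrbit G r ∧ O.ncard = 1} := by
    ext O
    constructor
    · rintro ⟨f, ⟨hf, hfi, hfd⟩, rfl⟩
      obtain ⟨x, hx, rfl⟩ := exists_U (K := AlgebraicClosure F) hQ f hf hfi
      have hcnt := (deg_count hQ x hx).2 (sq_of_lt hQ _ hf hfi (by rw [hfd]; exact hm))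
      rw [hfd, hG] at hcnt
      rw [← hΦ x hx]
      rcases orbit_card hQ hp x hx with h1 | h1
      · right
        rw [h1, one_mul] at hcnt
        exact ⟨_, memNR_minpoly hQ x hx, minpoly.irreducible (hint x), hcnt, rfl, h1⟩
      · left
        rw [h1, hG, mul_comm] at hcnt
        exact ⟨_, memNR_minpoly hQ x hx, minpoly.irreducible (hint x),
          Nat.eq_of_mul_eq_mul_right hs.pos hcnt, rfl, h1.trans hG⟩
    · intro hO
      obtain ⟨r, hr, hri, hOr, hcnt⟩ : ∃ r : F[X], memNR G r ∧ Irreducible r ∧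
          O = polyOrbit G r ∧ (polyOrbit G r).ncard * r.natDegree = m * s := by
        rcases hO with ⟨r, hr, hri, hd, rfl, hc⟩ | ⟨r, hr, hri, hd, rfl, hc⟩
        · exact ⟨r, hr, hri, rfl, by rw [hc, hd, mul_comm]⟩
        · exact ⟨r, hr, hri, rfl, by rw [hc, hd, one_mul]⟩
      obtain ⟨x, hxr⟩ := IsAlgClosed.exists_aeval_eq_zero (AlgebraicClosure F) r
        hri.degree_pos.ne'
      have hx := U_of_memNR hQ r hr x hxr
      have hrx : r = minpoly F x := minpoly.eq_of_irreducible_of_monic hri hxr hr.1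
      subst hrx
      obtain ⟨hle, heq⟩ := deg_count hQ x hx
      rw [hcnt, hG] at hle heq
      have hle' := Nat.le_of_mul_le_mul_right hle hs.pos
      have heq' := heq (sq_of_lt hQ _ (minpoly.monic (hint _)) (minpoly.irreducible (hint _))
        (lt_of_lt_of_le hm hle'))
      refine ⟨minpoly F (qv g h x), ⟨minpoly.monic (hint _), minpoly.irreducible (hint _),
        (Nat.eq_of_mul_eq_mul_right hs.pos heq').symm⟩, ?_⟩
      rw [hOr, hΦ x hx]
  have hfin := (finite_deg (F := F) m).image Φ
  rw [himg, Set.finite_union] at hfin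
  rw [← Set.ncard_image_of_injOn hinj, himg, Set.ncard_union_eq ?_ hfin.1 hfin.2]
  · rfl
  · rw [Set.disjoint_left]
    rintro O ⟨r, -, -, -, -, h1⟩ ⟨r', -, -, -, -, h2⟩
    exact hs.one_lt.ne' (h1.symm.trans h2)
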